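/- arXiv:math/0409284 — 2 statements merged into one kernel-verified Lean document; each statement's English description precedes it below -/
import Mathlib

section
/- For all A, B ∈ GL(2,ℝ)⁺ and every w ∈ FreeGroup (Fin 2), the hyperbolic translation lengths of w(A,B) and of w^R(A,B) on the upper half-plane are equal: ⨅ z : ℍ, dist z (w(A,B) • z) = ⨅ z : ℍ, dist z (w^R(A,B) • z). -/
open scoped MatrixGroups UpperHalfPlane

set_option synthInstance.maxHeartbeats 1000000

/-- The palindromic reverse `w^R = (σ w)⁻¹` of a word `w ∈ F(x,y)`, where `σ` sends each
generator to its inverse: the word `w` read backwards without inverting its letters. -/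
def palRev (w : FreeGroup (Fin 2)) : FreeGroup (Fin 2) :=
  (FreeGroup.lift (fun i : Fin 2 => (FreeGroup.of i)⁻¹) w)⁻¹

namespace Matrix

/-- The polarized Cayley-Hamilton identity. -/
theorem mul_add_mul_swap_fin_two {R : Type*} [CommRing R] (A B : Matrix (Fin 2) (Fin 2) R) :
    A * B + B * A = B.trace • A + A.trace • B + ((A * B).trace - A.trace * B.trace) • 1 := by
  ext i j
  fin_cases i <;> fin_cases j <;>
    simp [Matrix.mul_apply, Matrix.trace, Fin.sum_univ_two] <;> ring

theorem mul_self_fin_two {R : Type*} [CommRing R] (A : Matrix (Fin 2) (Fin 2) R) :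
    A * A = A.trace • A - A.det • 1 := by
  ext i j
  fin_cases i <;> fin_cases j <;>
    simp [Matrix.mul_apply, Matrix.trace, Fin.sum_univ_two, Matrix.det_fin_two] <;> ring

theorem inv_fin_two {K : Type*} [Field K] (A : Matrix (Fin 2) (Fin 2) K) :
    A⁻¹ = A.det⁻¹ • (A.trace • 1 - A) := by
  rw [inv_def, Ring.inverse_eq_inv']
  congr 1
  ext i j
  fin_cases i <;> fin_cases j <;> simp [adjugate_fin_two, trace_fin_two]

end Matrix

/-- `X` and `Y` have the same coordinates with respect to `1, A, B, AB` and `1, A, B, BA`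
respectively. For `2 × 2` matrices, this holds for the values of a word and of its reverse. -/
def PalindromicPair {R : Type*} [CommRing R] (A B X Y : Matrix (Fin 2) (Fin 2) R) : Prop :=
  ∃ p q r s : R, X = p • 1 + q • A + r • B + s • (A * B) ∧
    Y = p • 1 + q • A + r • B + s • (B * A)

namespace PalindromicPair

section CommRing

variable {R : Type*} [CommRing R] {A B X Y X' Y' : Matrix (Fin 2) (Fin 2) R}

theorem one : PalindromicPair A B 1 1 :=
  ⟨1, 0, 0, 0, by simp, by simp⟩

theorem trace_eq (h : PalindromicPair A B X Y) : X.trace = Y.trace := by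
  obtain ⟨p, q, r, s, rfl, rfl⟩ := h
  simp [Matrix.trace_mul_comm A B]

theorem sub (h : PalindromicPair A B X Y) (h' : PalindromicPair A B X' Y') :
    PalindromicPair A B (X - X') (Y - Y') := by
  obtain ⟨p, q, r, s, rfl, rfl⟩ := h
  obtain ⟨p', q', r', s', rfl, rfl⟩ := h'
  exact ⟨p - p', q - q', r - r', s - s', by module, by module⟩

theorem smul (c : R) (h : PalindromicPair A B X Y) : PalindromicPair A B (c • X) (c • Y) := by
  obtain ⟨p, q, r, s, rfl, rfl⟩ := h
  exact ⟨c * p, c * q, c * r, c * s, by module, by module⟩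

theorem symm (h : PalindromicPair A B X Y) : PalindromicPair B A X Y := by
  obtain ⟨p, q, r, s, rfl, rfl⟩ := h
  refine ⟨p + s * ((A * B).trace - A.trace * B.trace), r + s * A.trace, q + s * B.trace, -s, ?_, ?_⟩
  all_goals linear_combination (norm := module) s • Matrix.mul_add_mul_swap_fin_two A B

theorem mul_fst (h : PalindromicPair A B X Y) : PalindromicPair A B (A * X) (Y * A) := by
  obtain ⟨p, q, r, s, rfl, rfl⟩ := h
  refine ⟨-q * A.det, p + q * A.trace, -s * A.det, r + s * A.trace, ?_, ?_⟩
  · simp only [mul_add, Matrix.mul_smul, mul_one, ← mul_assoc, Matrix.mul_self_fin_two A, sub_mul,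
      Matrix.smul_mul, one_mul]
    module
  · simp only [add_mul, Matrix.smul_mul, one_mul, mul_assoc, Matrix.mul_self_fin_two A, mul_sub,
      Matrix.mul_smul, mul_one]
    module

theorem mul_snd (h : PalindromicPair A B X Y) : PalindromicPair A B (B * X) (Y * B) :=
  h.symm.mul_fst.symm

end CommRing

variable {K : Type*} [Field K] {A B X Y : Matrix (Fin 2) (Fin 2) K}

theorem inv_mul_fst (h : PalindromicPair A B X Y) : PalindromicPair A B (A⁻¹ * X) (Y * A⁻¹) := by
  simpa [Matrix.inv_fin_two A, sub_mul, mul_sub] using ((h.smul A.trace).sub h.mul_fst).smul A.det⁻¹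

theorem inv_mul_snd (h : PalindromicPair A B X Y) : PalindromicPair A B (B⁻¹ * X) (Y * B⁻¹) :=
  h.symm.inv_mul_fst.symm

end PalindromicPair

theorem palRev_mul (v w : FreeGroup (Fin 2)) : palRev (v * w) = palRev w * palRev v := by
  simp [palRev]

/-- Left multiplication by a word and right multiplication by its reverse preserve
palindromic pairs. -/
theorem PalindromicPair.lift_mul {K : Type*} [Field K] (A B : GL (Fin 2) K)
    (w : FreeGroup (Fin 2)) :
    ∀ {X Y : Matrix (Fin 2) (Fin 2) K}, PalindromicPair (A : Matrix (Fin 2) (Fin 2) K) B X Y →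
      PalindromicPair (A : Matrix (Fin 2) (Fin 2) K) B
        ((FreeGroup.lift ![A, B] w : GL (Fin 2) K) * X)
        (Y * (FreeGroup.lift ![A, B] (palRev w) : GL (Fin 2) K)) := by
  induction w using FreeGroup.induction_on with
  | C1 => simp [palRev]
  | of i =>
    intro X Y h
    fin_cases i
    · simpa [palRev] using h.mul_fst
    · simpa [palRev] using h.mul_snd
  | inv_of i _ =>
    intro X Y h
    fin_cases i
    · simpa [palRev] using h.inv_mul_fst
    · simpa [palRev] using h.inv_mul_snd
  | mul v w hv hw =>
    intro X Y h
    simpa [palRev_mul, mul_assoc] using hv (hw h)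

theorem trace_lift_palRev {K : Type*} [Field K] (A B : GL (Fin 2) K) (w : FreeGroup (Fin 2)) :
    (FreeGroup.lift ![A, B] w : GL (Fin 2) K).val.trace =
      (FreeGroup.lift ![A, B] (palRev w) : GL (Fin 2) K).val.trace := by
  simpa using (PalindromicPair.lift_mul A B w PalindromicPair.one).trace_eq

theorem det_lift_palRev {K : Type*} [Field K] (A B : GL (Fin 2) K) (w : FreeGroup (Fin 2)) :
    (FreeGroup.lift ![A, B] w : GL (Fin 2) K).val.det =
      (FreeGroup.lift ![A, B] (palRev w) : GL (Fin 2) K).val.det := by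
  induction w using FreeGroup.induction_on with
  | C1 => simp [palRev]
  | of i => simp [palRev]
  | inv_of i _ => simp [palRev]
  | mul v w hv hw => simp [palRev_mul, hv, hw, mul_comm]

namespace UpperHalfPlane

theorem cosh_dist_smul {g : GL (Fin 2) ℝ} (hg : 0 < g.val.det) (z : ℍ) :
    Real.cosh (dist z (g • z)) = 1 + (g.val.trace ^ 2 - 4 * g.val.det +
      ((g 1 0 * (z.re ^ 2 + z.im ^ 2) + (g 1 1 - g 0 0) * z.re - g 0 1) / z.im) ^ 2) /
        (2 * g.val.det) := by
  have hd : denom g z ≠ 0 := denom_ne_zero g z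
  have hn : Complex.normSq (denom g z) ≠ 0 := by simp
  have hz := z.im_ne_zero
  have hdist : dist (z : ℂ) (g • z : ℍ) ^ 2 =
      Complex.normSq (z * denom g z - num g z) / Complex.normSq (denom g z) := by
    rw [coe_smul_of_det_pos (by simpa using hg), Complex.dist_eq, Complex.sq_norm,
      ← Complex.normSq_div]
    congr 1
    field_simp
  rw [cosh_dist, hdist, im_smul_eq_div_normSq, Matrix.GeneralLinearGroup.val_det_apply,
    abs_of_pos hg]
  have hg' := hg.ne'
  have key : Complex.normSq (z * denom g z - num g z) =
      (g.val.trace ^ 2 - 4 * g.val.det) * z.im ^ 2 +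
        (g 1 0 * (z.re ^ 2 + z.im ^ 2) + (g 1 1 - g 0 0) * z.re - g 0 1) ^ 2 := by
    simp [Complex.normSq_apply, denom, num, Matrix.trace_fin_two, Matrix.det_fin_two]
    ring
  rw [key]
  field_simp

/-- The quantity controlling the displacement of `!![a, b; c, d]` comes arbitrarily close to the
lower bound `max Δ 0`, where `Δ = (d - a) ^ 2 + 4 * b * c`. -/
theorem exists_displacement_lt (a b c d : ℝ) {k : ℝ} (hk : 0 < k)
    (hk' : (d - a) ^ 2 + 4 * b * c < k) :
    ∃ z : ℍ, (d - a) ^ 2 + 4 * b * c +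
      ((c * (z.re ^ 2 + z.im ^ 2) + (d - a) * z.re - b) / z.im) ^ 2 < k := by
  rcases eq_or_ne c 0 with rfl | hc
  · rcases eq_or_ne d a with rfl | hda
    · obtain ⟨y, hy, hyk⟩ : ∃ y : ℝ, 0 < y ∧ b ^ 2 / k < y ^ 2 :=
        ⟨b ^ 2 / k + 1, by positivity, by nlinarith [show 0 ≤ b ^ 2 / k by positivity]⟩
      refine ⟨⟨⟨0, y⟩, hy⟩, ?_⟩
      rw [div_lt_iff₀ hk] at hyk
      simp only [UpperHalfPlane.mk_re, UpperHalfPlane.mk_im]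
      simp only [sub_self, zero_mul, mul_zero, add_zero, zero_sub, zero_pow two_ne_zero, zero_add,
        div_pow, neg_sq]
      rw [div_lt_iff₀ (by positivity)]
      linarith
    · have := sub_ne_zero.2 hda
      refine ⟨⟨⟨b / (d - a), 1⟩, one_pos⟩, ?_⟩
      simpa [mul_div_cancel₀ _ this] using hk'
  · set D := (d - a) ^ 2 + 4 * b * c with hD
    obtain ⟨s, hs, hsk⟩ : ∃ s : ℝ, 0 < s ∧ (s + D / 4) ^ 2 < k * s := by
      rcases lt_trichotomy D 0 with h | h | h
      · exact ⟨-D / 4, by linarith, by nlinarith⟩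
      · exact ⟨k / 2, by linarith, by rw [h]; nlinarith⟩
      · exact ⟨D / 4, by linarith, by nlinarith⟩
    have hy : 0 < √s / |c| := by positivity
    have hy2 : (√s / |c|) ^ 2 = s / c ^ 2 := by rw [div_pow, Real.sq_sqrt hs.le, sq_abs]
    refine ⟨⟨⟨(a - d) / (2 * c), √s / |c|⟩, hy⟩, ?_⟩
    simp only [UpperHalfPlane.mk_re, UpperHalfPlane.mk_im]
    rw [div_pow _ (√s / |c|), hy2]
    have : D + (c * (((a - d) / (2 * c)) ^ 2 + s / c ^ 2) + (d - a) * ((a - d) / (2 * c)) - b) ^ 2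
        / (s / c ^ 2) = (s + D / 4) ^ 2 / s := by
      rw [hD]
      field_simp
      ring
    rwa [this, div_lt_iff₀ hs]

theorem iInf_dist_smul_le_of_trace_eq_of_det_eq {g h : GL (Fin 2) ℝ} (hg : 0 < g.val.det)
    (htr : g.val.trace = h.val.trace) (hdet : g.val.det = h.val.det) :
    ⨅ z : ℍ, dist z (g • z) ≤ ⨅ z : ℍ, dist z (h • z) := by
  refine le_ciInf fun z ↦ le_of_forall_gt_imp_ge_of_dense fun r hr ↦ ?_
  have hr0 : 0 < r := dist_nonneg.trans_lt hr
  have hcosh : Real.cosh (dist z (h • z)) < Real.cosh r := by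
    rwa [Real.cosh_lt_cosh, abs_of_nonneg dist_nonneg, abs_of_pos hr0]
  have hdisc : (g 1 1 - g 0 0) ^ 2 + 4 * g 0 1 * g 1 0 = g.val.trace ^ 2 - 4 * g.val.det := by
    rw [Matrix.trace_fin_two, Matrix.det_fin_two]
    ring
  obtain ⟨x, hx⟩ := exists_displacement_lt (g 0 0) (g 0 1) (g 1 0) (g 1 1)
    (k := (Real.cosh r - 1) * (2 * g.val.det))
    (mul_pos (sub_pos.2 (Real.one_lt_cosh.2 hr0.ne')) (by positivity)) (by
      rw [cosh_dist_smul (hdet ▸ hg), ← htr, ← hdet, ← lt_sub_iff_add_lt',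
        div_lt_iff₀ (by positivity)] at hcosh
      rw [hdisc]
      exact (le_add_of_nonneg_right (sq_nonneg _)).trans_lt hcosh)
  refine (ciInf_le ⟨0, Set.forall_mem_range.2 fun _ ↦ dist_nonneg⟩ x).trans ?_
  have hlt : Real.cosh (dist x (g • x)) < Real.cosh r := by
    rw [cosh_dist_smul hg, ← lt_sub_iff_add_lt', div_lt_iff₀ (by positivity), ← hdisc]
    exact hx
  rw [Real.cosh_lt_cosh, abs_of_nonneg dist_nonneg, abs_of_pos hr0] at hlt
  exact hlt.le

end UpperHalfPlane

/-- The hyperbolic translation lengths of `w(A,B)` and `w^R(A,B)` on the upper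
half-plane are equal, for all `A, B ∈ GL(2,ℝ)⁺`. -/
theorem translation_length_palindromic_reverse
    (A B : Matrix.GLPos (Fin 2) ℝ) (w : FreeGroup (Fin 2)) :
    (⨅ z : ℍ, dist z ((FreeGroup.lift ![A, B] w : Matrix.GLPos (Fin 2) ℝ) • z)) =
      ⨅ z : ℍ, dist z ((FreeGroup.lift ![A, B] (palRev w) : Matrix.GLPos (Fin 2) ℝ) • z) := by
  set g : Matrix.GLPos (Fin 2) ℝ := FreeGroup.lift ![A, B] w with hg
  set h : Matrix.GLPos (Fin 2) ℝ := FreeGroup.lift ![A, B] (palRev w) with hh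
  have hcoe (v : FreeGroup (Fin 2)) :
      ((FreeGroup.lift ![A, B] v : Matrix.GLPos (Fin 2) ℝ) : GL (Fin 2) ℝ) =
        FreeGroup.lift ![(A : GL (Fin 2) ℝ), (B : GL (Fin 2) ℝ)] v := by
    refine DFunLike.congr_fun (f := (Matrix.GLPos (Fin 2) ℝ).subtype.comp (FreeGroup.lift ![A, B]))
      (FreeGroup.ext_hom _ _ fun i ↦ ?_) v
    fin_cases i <;> simp
  have htr : (g : GL (Fin 2) ℝ).val.trace = (h : GL (Fin 2) ℝ).val.trace := by
    rw [hg, hh, hcoe, hcoe]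
    exact trace_lift_palRev _ _ w
  have hdet : (g : GL (Fin 2) ℝ).val.det = (h : GL (Fin 2) ℝ).val.det := by
    rw [hg, hh, hcoe, hcoe]
    exact det_lift_palRev _ _ w
  exact le_antisymm
    (UpperHalfPlane.iInf_dist_smul_le_of_trace_eq_of_det_eq g.2 htr hdet)
    (UpperHalfPlane.iInf_dist_smul_le_of_trace_eq_of_det_eq h.2 htr.symm hdet.symm)
end

section
/- Let k ≥ 2, let g be a nontrivial element of FreeGroup (Fin k), let ℓ be a cyclically reduced representative of g, and let i : Fin k. Then, as integers, k · n(ℓ; a_i) = ‖g‖ + Σ_{j ≠ i} (‖φ_{i,j}(g)‖ − ‖φ_{j,i}(g)‖), where a_i is the i-th generator and the sum is over all j : Fin k with j ≠ i. -/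
/-- The cyclically reduced length of an element of a free group: the minimal
reduced word length among its conjugates. -/
noncomputable def cyclLen {α : Type*} [DecidableEq α] (g : FreeGroup α) : ℕ :=
  sInf {n : ℕ | ∃ x : FreeGroup α, FreeGroup.norm (x * g * x⁻¹) = n}

/-- `ℓ` is a cyclically reduced representative of `g`. -/
def IsCyclRep {k : ℕ} (g : FreeGroup (Fin k)) (ℓ : List (Fin k × Bool)) : Prop :=
  FreeGroup.reduce ℓ = ℓ ∧ IsConj (FreeGroup.mk ℓ) g ∧ ℓ.length = cyclLen g

/-- `n(ℓ; a)`: the total number of occurrences of the letters `a` and `a⁻¹` in `ℓ`. -/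
def nLetter {k : ℕ} (ℓ : List (Fin k × Bool)) (a : Fin k) : ℕ :=
  (ℓ.filter (fun p => decide (p.1 = a))).length

open FreeGroup in
/-- The length of a positive power in terms of the cyclic reduction. -/
theorem norm_pow_eq_conjugator_add {α : Type*} [DecidableEq α] (g : FreeGroup α) (n : ℕ) :
    norm (g ^ (n + 1)) = 2 * (reduceCyclically.conjugator g.toWord).length +
      (n + 1) * (reduceCyclically g.toWord).length := by
  rw [FreeGroup.norm, toWord_pow, reduceCyclically.reduce_flatten_replicate_succ isReduced_toWord]
  simp
  ring

open FreeGroup in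
theorem length_reduceCyclically_le_norm_conj {α : Type*} [DecidableEq α] (g x : FreeGroup α) :
    (reduceCyclically g.toWord).length ≤ norm (x * g * x⁻¹) := by
  set c := (reduceCyclically g.toWord).length
  set N := norm (x * g * x⁻¹)
  have norm_pow_le : ∀ n : ℕ, norm ((x * g * x⁻¹) ^ n) ≤ n * N := by
    intro n
    induction n with
    | zero => simp
    | succ n ih =>
      rw [pow_succ]
      have := norm_mul_le ((x * g * x⁻¹) ^ n) (x * g * x⁻¹)
      rw [Nat.add_mul]
      omega
  have growth : ∀ n : ℕ, (n + 1) * c ≤ (n + 1) * N + 2 * norm x := by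
    intro n
    have e : g ^ (n + 1) = x⁻¹ * (x * g * x⁻¹) ^ (n + 1) * x := by
      rw [conj_pow]; group
    have h1 := norm_mul_le (x⁻¹ * (x * g * x⁻¹) ^ (n + 1)) x
    have h2 := norm_mul_le x⁻¹ ((x * g * x⁻¹) ^ (n + 1))
    rw [← e, norm_pow_eq_conjugator_add] at h1
    change _ + (n + 1) * c ≤ _ at h1
    rw [norm_inv_eq] at h2
    have h3 := norm_pow_le (n + 1)
    omega
  by_contra! hlt
  have h := growth (2 * norm x)
  nlinarith

open FreeGroup in
theorem cyclLen_eq_length_reduceCyclically {α : Type*} [DecidableEq α] (g : FreeGroup α) :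
    cyclLen g = (reduceCyclically g.toWord).length := by
  apply le_antisymm
  · apply Nat.sInf_le
    refine ⟨(mk (reduceCyclically.conjugator g.toWord))⁻¹, ?_⟩
    have e : g = mk (reduceCyclically.conjugator g.toWord) * mk (reduceCyclically g.toWord) *
        (mk (reduceCyclically.conjugator g.toWord))⁻¹ := by
      rw [inv_mk, mul_mk, mul_mk, reduceCyclically.conj_conjugator_reduceCyclically, mk_toWord]
    have e' : (mk (reduceCyclically.conjugator g.toWord))⁻¹ * g *
        (mk (reduceCyclically.conjugator g.toWord))⁻¹⁻¹ = mk (reduceCyclically g.toWord) := by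
      nth_rw 2 [e]
      group
    rw [e', FreeGroup.norm, toWord_mk,
      (reduceCyclically.isCyclicallyReduced isReduced_toWord).isReduced.reduce_eq]
  · rw [cyclLen]
    refine le_csInf ⟨norm (1 * g * 1⁻¹), 1, rfl⟩ ?_
    rintro n ⟨x, rfl⟩
    exact length_reduceCyclically_le_norm_conj g x

theorem cyclLen_conj {α : Type*} [DecidableEq α] (g y : FreeGroup α) :
    cyclLen (y * g * y⁻¹) = cyclLen g := by
  unfold cyclLen
  congr 1
  ext n
  constructor
  · rintro ⟨x, hx⟩
    exact ⟨x * y, by rw [← hx]; congr 1; group⟩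
  · rintro ⟨x, hx⟩
    exact ⟨x * y⁻¹, by rw [← hx]; congr 1; group⟩

theorem cyclLen_eq_of_isConj {α : Type*} [DecidableEq α] {g h : FreeGroup α} (H : IsConj g h) :
    cyclLen g = cyclLen h := by
  obtain ⟨y, rfl⟩ := isConj_iff.mp H
  exact (cyclLen_conj g y).symm

open FreeGroup in
theorem norm_pow_eq_norm_add_cyclLen {α : Type*} [DecidableEq α] (g : FreeGroup α) :
    norm (g ^ 2) = norm g + cyclLen g := by
  have h1 := norm_pow_eq_conjugator_add g 0
  have h2 := norm_pow_eq_conjugator_add g 1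
  rw [cyclLen_eq_length_reduceCyclically]
  simp only [zero_add, pow_one, one_mul, Nat.reduceAdd] at h1 h2
  omega

open FreeGroup in
/-- The square of a cyclically reduced word is reduced. -/
theorem IsCyclRep.isReduced_append_self {k : ℕ} {g : FreeGroup (Fin k)}
    {l : List (Fin k × Bool)} (h : IsCyclRep g l) : FreeGroup.IsReduced (l ++ l) := by
  obtain ⟨hred, hconj, hlen⟩ := h
  rw [isReduced_iff_reduce_eq]
  have hw : (mk l).toWord = l := by rw [toWord_mk, hred]
  have hsq : (mk l ^ 2).toWord = reduce (l ++ l) := by rw [pow_two, mul_mk, toWord_mk]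
  have hsub : (reduce (l ++ l)).Sublist (l ++ l) := by
    have := toWord_mul_sublist (mk l) (mk l)
    rwa [← pow_two, hsq, hw] at this
  apply hsub.eq_of_length
  have h2 := norm_pow_eq_norm_add_cyclLen (mk l)
  rw [cyclLen_eq_of_isConj hconj, FreeGroup.norm, FreeGroup.norm, hsq, hw] at h2
  rw [h2, List.length_append, ← hlen]

/-- The number of places where the letters `p q⁻¹` or `q p⁻¹` are adjacent in a word. -/
def adjacentCount {α : Type*} [DecidableEq α] (p q : α) : List (α × Bool) → ℕ
  | x :: y :: t =>
    (if x = (p, true) ∧ y = (q, false) ∨ x = (q, true) ∧ y = (p, false) then 1 else 0) +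
      adjacentCount p q (y :: t)
  | _ => 0

theorem adjacentCount_comm {α : Type*} [DecidableEq α] (p q : α) (l : List (α × Bool)) :
    adjacentCount p q l = adjacentCount q p l := by
  induction l with
  | nil => rfl
  | cons x t ih =>
    cases t with
    | nil => rfl
    | cons y t =>
      simp only [adjacentCount, ih]
      congr 2
      rw [or_comm]

theorem adjacentCount_cons_false {α : Type*} [DecidableEq α] (p q r : α) (l : List (α × Bool)) :
    adjacentCount p q ((r, false) :: l) = adjacentCount p q l := by
  cases l <;> simp [adjacentCount]

theorem adjacentCount_cons {α : Type*} [DecidableEq α] {p q : α} {x : α × Bool}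
    {l : List (α × Bool)} (h₁ : x = (p, true) → (q, false) ∉ l.head?)
    (h₂ : x = (q, true) → (p, false) ∉ l.head?) :
    adjacentCount p q (x :: l) = adjacentCount p q l := by
  cases l with
  | nil => rfl
  | cons y t =>
    simp only [List.head?_cons, Option.mem_def, Option.some.injEq] at h₁ h₂
    rw [adjacentCount, if_neg, zero_add]
    rintro (h | h)
    · exact h₁ h.1 h.2
    · exact h₂ h.1 h.2

theorem isReduced_cons {α : Type*} {x : α × Bool} {l : List (α × Bool)} :
    FreeGroup.IsReduced (x :: l) ↔ (x.1, !x.2) ∉ l.head? ∧ FreeGroup.IsReduced l := by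
  cases l with
  | nil => simp [FreeGroup.IsReduced]
  | cons y t =>
    obtain ⟨a, b⟩ := x
    obtain ⟨c, d⟩ := y
    simp only [FreeGroup.IsReduced, List.isChain_cons_cons, List.head?_cons, Option.mem_def,
      Option.some.injEq, Prod.mk.injEq, not_and]
    refine and_congr_left fun _ => ?_
    cases b <;> cases d <;> simp [eq_comm]

theorem nLetter_cons {k : ℕ} (x : Fin k × Bool) (l : List (Fin k × Bool)) (a : Fin k) :
    nLetter (x :: l) a = (if x.1 = a then 1 else 0) + nLetter l a := by
  unfold nLetter
  by_cases h : x.1 = a <;> simp [h, add_comm]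

theorem nLetter_append {k : ℕ} (l m : List (Fin k × Bool)) (a : Fin k) :
    nLetter (l ++ m) a = nLetter l a + nLetter m a := by
  simp [nLetter]

theorem sum_nLetter {k : ℕ} (l : List (Fin k × Bool)) : ∑ a, nLetter l a = l.length := by
  induction l with
  | nil => simp [nLetter]
  | cons x t ih => simp [nLetter_cons, Finset.sum_add_distrib, ih, add_comm]

open FreeGroup in
/-- The reduced form of the image of a reduced word under `p ↦ p q`, with its length and a
description of its first letter. -/
theorem exists_reduced_image {k : ℕ} {p q : Fin k} (hpq : p ≠ q)
    (f : FreeGroup (Fin k) →* FreeGroup (Fin k)) (hp : f (of p) = of p * of q)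
    (hf : ∀ a, a ≠ p → f (of a) = of a) (n : ℕ) (w : List (Fin k × Bool)) (hn : w.length ≤ n)
    (hw : FreeGroup.IsReduced w) :
    ∃ r : List (Fin k × Bool), FreeGroup.IsReduced r ∧ mk r = f (mk w) ∧
      r.length + 2 * adjacentCount p q w = w.length + nLetter w p ∧
      ∀ y ∈ r.head?, ∃ x ∈ w.head?, (y = x ∧ y ≠ (p, false)) ∨
        (y = (q, false) ∧ x = (p, false)) ∨ (y = (p, false) ∧ x = (q, true)) := by
  have mk_cons : ∀ (x : Fin k × Bool) (l : List (Fin k × Bool)), mk (x :: l) = mk [x] * mk l :=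
    fun x l => by rw [mul_mk]; rfl
  have mk_true : ∀ a : Fin k, mk [(a, true)] = of a := fun a => rfl
  have mk_false : ∀ a : Fin k, mk [(a, false)] = (of a)⁻¹ := fun a => rfl
  have hq := hf q hpq.symm
  induction n generalizing w with
  | zero =>
    obtain rfl : w = [] := List.length_eq_zero_iff.mp (by omega)
    exact ⟨[], hw, by rw [← one_eq_mk, _root_.map_one], by simp [adjacentCount, nLetter], by simp⟩
  | succ n ih =>
    cases w with
    | nil => exact ih [] (by simp) hw
    | cons x t =>
      obtain ⟨hxt, ht⟩ := isReduced_cons.mp hw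
      simp only [List.length_cons] at hn
      by_cases hx1 : x = (p, true) ∧ (q, false) ∈ t.head?
      · obtain ⟨rfl, hh⟩ := hx1
        obtain ⟨s, rfl⟩ := List.head?_eq_some_iff.mp hh
        obtain ⟨hs, hs'⟩ := isReduced_cons.mp ht
        obtain ⟨r, hr, hmk, hlen, hhead⟩ := ih s (by simp at hn; omega) hs'
        refine ⟨(p, true) :: r, isReduced_cons.mpr ⟨?_, hr⟩, ?_, ?_, ?_⟩
        · intro hy
          obtain ⟨x, hx, h⟩ := hhead _ hy
          simp at h hs
          simp_all
        · rw [mk_cons _ r, mk_cons _ (_ :: s), mk_cons _ s]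
          simp only [mk_true, mk_false, _root_.map_mul, _root_.map_inv, hp, hq, hmk]
          group
        · simp [adjacentCount, adjacentCount_cons_false, nLetter_cons, hpq.symm]
          omega
        · simp
      by_cases hx2 : x = (q, true) ∧ (p, false) ∈ t.head?
      · obtain ⟨rfl, hh⟩ := hx2
        obtain ⟨s, rfl⟩ := List.head?_eq_some_iff.mp hh
        obtain ⟨hs, hs'⟩ := isReduced_cons.mp ht
        obtain ⟨r, hr, hmk, hlen, hhead⟩ := ih s (by simp at hn; omega) hs'
        refine ⟨(p, false) :: r, isReduced_cons.mpr ⟨?_, hr⟩, ?_, ?_, ?_⟩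
        · intro hy
          obtain ⟨x, hx, h⟩ := hhead _ hy
          simp at h hs
          simp_all
        · rw [mk_cons _ r, mk_cons _ (_ :: s), mk_cons _ s]
          simp only [mk_true, mk_false, _root_.map_mul, _root_.map_inv, hp, hq, hmk]
          group
        · simp [adjacentCount, adjacentCount_cons_false, nLetter_cons, hpq.symm]
          omega
        · simp
      have hcount : adjacentCount p q (x :: t) = adjacentCount p q t :=
        adjacentCount_cons (fun e h => hx1 ⟨e, h⟩) (fun e h => hx2 ⟨e, h⟩)
      obtain ⟨r, hr, hmk, hlen, hhead⟩ := ih t (by omega) ht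
      by_cases hx3 : x = (p, true)
      · subst hx3
        refine ⟨(p, true) :: (q, true) :: r,
          isReduced_cons.mpr ⟨by simp [hpq.symm], isReduced_cons.mpr ⟨?_, hr⟩⟩, ?_, ?_, ?_⟩
        · intro hy
          obtain ⟨x, hx, h⟩ := hhead _ hy
          simp at h hxt hx1
          rcases h with h | h | h <;> simp_all
        · rw [mk_cons _ (_ :: r), mk_cons _ r, mk_cons _ t]
          simp only [mk_true, _root_.map_mul, hp, hmk]
          group
        · simp [hcount, nLetter_cons]
          omega
        · simp
      by_cases hx4 : x = (p, false)
      · subst hx4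
        refine ⟨(q, false) :: (p, false) :: r,
          isReduced_cons.mpr ⟨by simp [hpq], isReduced_cons.mpr ⟨?_, hr⟩⟩, ?_, ?_, ?_⟩
        · intro hy
          obtain ⟨x, hx, h⟩ := hhead _ hy
          simp at h hxt
          simp_all
        · rw [mk_cons _ (_ :: r), mk_cons _ r, mk_cons _ t]
          simp only [mk_false, _root_.map_mul, _root_.map_inv, hp, hmk]
          group
        · simp [hcount, nLetter_cons]
          omega
        · simp
      · obtain ⟨a, b⟩ := x
        have hap : a ≠ p := by
          rintro rfl
          cases b <;> simp_all
        refine ⟨(a, b) :: r, isReduced_cons.mpr ⟨?_, hr⟩, ?_, ?_, ?_⟩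
        · intro hy
          obtain ⟨x, hx, h⟩ := hhead _ hy
          rcases h with h | h | h
          · rw [h.1] at hxt; exact hxt hx
          · cases b <;> simp_all
          · simp_all
        · rw [mk_cons _ r, mk_cons _ t, _root_.map_mul, hmk]
          cases b <;> simp [mk_true, mk_false, hf a hap]
        · simp [hcount, nLetter_cons, hap]
          omega
        · simp [hap]

open FreeGroup in
theorem norm_nielsen_image {k : ℕ} {p q : Fin k} (hpq : p ≠ q)
    (f : FreeGroup (Fin k) →* FreeGroup (Fin k)) (hp : f (of p) = of p * of q)
    (hf : ∀ a, a ≠ p → f (of a) = of a) {w : List (Fin k × Bool)} (hw : FreeGroup.IsReduced w) :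
    norm (f (mk w)) + 2 * adjacentCount p q w = w.length + nLetter w p := by
  obtain ⟨r, hr, hmk, hlen, -⟩ := exists_reduced_image hpq f hp hf w.length w le_rfl hw
  rwa [← hmk, FreeGroup.norm, toWord_mk, hr.reduce_eq]

open FreeGroup in
theorem IsCyclRep.cyclLen_nielsen_image {k : ℕ} {g : FreeGroup (Fin k)}
    {l : List (Fin k × Bool)} (h : IsCyclRep g l) {p q : Fin k} (hpq : p ≠ q)
    (f : FreeGroup (Fin k) →* FreeGroup (Fin k)) (hp : f (of p) = of p * of q)
    (hf : ∀ a, a ≠ p → f (of a) = of a) :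
    cyclLen (f g) + 2 * adjacentCount p q (l ++ l) =
      l.length + nLetter l p + 2 * adjacentCount p q l := by
  have h1 := norm_nielsen_image hpq f hp hf (FreeGroup.IsReduced.of_reduce_eq h.1)
  have h2 := norm_nielsen_image hpq f hp hf h.isReduced_append_self
  have h3 := norm_pow_eq_norm_add_cyclLen (f (mk l))
  rw [← mul_mk, _root_.map_mul, ← pow_two, h3, cyclLen_eq_of_isConj (f.map_isConj h.2.1),
    nLetter_append, List.length_append] at h2
  omega

/-- Lemma 2.2: `k · n(ℓ; a_i) = ‖g‖ + Σ_{j ≠ i} (‖φ_{i,j} g‖ - ‖φ_{j,i} g‖)`, where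
`φ_{p,q}` is the Nielsen automorphism sending the `p`-th generator `a_p` to `a_p · a_q`
and fixing all other generators. -/
theorem letter_count_from_nielsen_lengths {k : ℕ} (hk : 2 ≤ k)
    (g : FreeGroup (Fin k)) (hg : g ≠ 1)
    (ℓ : List (Fin k × Bool)) (hℓ : IsCyclRep g ℓ) (i : Fin k)
    (φ : Fin k → Fin k → (FreeGroup (Fin k) ≃* FreeGroup (Fin k)))
    (hφ : ∀ p q : Fin k, p ≠ q →
      φ p q (FreeGroup.of p) = FreeGroup.of p * FreeGroup.of q ∧
        ∀ a : Fin k, a ≠ p → φ p q (FreeGroup.of a) = FreeGroup.of a) :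
    (k : ℤ) * (nLetter ℓ i : ℤ) =
      (cyclLen g : ℤ) +
        ∑ j ∈ Finset.univ.filter (fun j : Fin k => j ≠ i),
          ((cyclLen (φ i j g) : ℤ) - (cyclLen (φ j i g) : ℤ)) := by
  have key : ∀ j ∈ Finset.univ.filter (fun j : Fin k => j ≠ i),
      (cyclLen (φ i j g) : ℤ) - (cyclLen (φ j i g) : ℤ) = nLetter ℓ i - nLetter ℓ j := by
    intro j hj
    have hji : j ≠ i := (Finset.mem_filter.mp hj).2
    have h1 := hℓ.cyclLen_nielsen_image hji.symm (φ i j).toMonoidHom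
      (hφ i j hji.symm).1 (hφ i j hji.symm).2
    have h2 := hℓ.cyclLen_nielsen_image hji (φ j i).toMonoidHom (hφ j i hji).1 (hφ j i hji).2
    rw [adjacentCount_comm j i, adjacentCount_comm j i] at h2
    simp only [MulEquiv.toMonoidHom_eq_coe, MonoidHom.coe_coe] at h1 h2
    omega
  have hsum : ∑ j ∈ Finset.univ.filter (fun j : Fin k => j ≠ i),
      ((nLetter ℓ i : ℤ) - nLetter ℓ j) = ∑ j, ((nLetter ℓ i : ℤ) - nLetter ℓ j) :=
    Finset.sum_filter_of_ne fun j _ hne hji => hne (by rw [hji, sub_self])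
  have htotal : ∑ j, (nLetter ℓ j : ℤ) = ℓ.length := mod_cast sum_nLetter ℓ
  rw [Finset.sum_congr rfl key, hsum, Finset.sum_sub_distrib, htotal, hℓ.2.2]
  simp
end
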